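/- arXiv:1905.04585 — 3 statements merged into one kernel-verified Lean document; each statement's English description precedes it below -/
import Mathlib

section
/- Let (Ω, 𝒜, μ) be a probability space equipped with a filtration (ℱ_k)_{k∈ℕ}, let c ≥ 0, and let (Y_k)_{k∈ℕ} be a real-valued process adapted to (ℱ_k) such that each Y_k is integrable, Y_k ≥ 0 μ-almost everywhere for every k, and μ[Y_{k+1} | ℱ_k] ≤ Y_k + c μ-almost everywhere for every k. Then for every real λ > 0 and every T_d ∈ ℕ, μ{ω ∈ Ω | ∃ k with 0 ≤ k < T_d and Y_k(ω) ≥ λ} ≤ (∫ Y_0 dμ + c·T_d)/λ. -/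
open MeasureTheory Filter

/-- The event that an adapted process reaches `lam` at some time before `n` is observable at any
time `m` with `n ≤ m + 1`. -/
theorem measurableSet_exists_lt_le_of_adapted {Ω : Type*} {mΩ : MeasurableSpace Ω}
    {ℱ : Filtration ℕ mΩ} {Y : ℕ → Ω → ℝ} (hadp : Adapted ℱ Y) (lam : ℝ) {n m : ℕ}
    (hnm : n ≤ m + 1) : MeasurableSet[ℱ m] {ω | ∃ k < n, lam ≤ Y k ω} := by
  have h_eq : {ω | ∃ k < n, lam ≤ Y k ω} = ⋃ k, ⋃ (_ : k < n), {ω | lam ≤ Y k ω} := by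
    ext ω
    simp
  rw [h_eq]
  refine MeasurableSet.iUnion fun k => MeasurableSet.iUnion fun hk => ?_
  exact ℱ.mono (by lia : k ≤ m) _ ((hadp k) measurableSet_Ici)

/-- A process whose conditional expected increments are at most `c` satisfies a maximal
inequality retaining the expectation over the event that `lam` has not been reached. -/
theorem mul_measureReal_add_setIntegral_compl_le
    {Ω : Type*} {mΩ : MeasurableSpace Ω} {μ : Measure Ω} [IsProbabilityMeasure μ]
    {ℱ : Filtration ℕ mΩ} {c : ℝ} (hc : 0 ≤ c)
    {Y : ℕ → Ω → ℝ} (hadp : Adapted ℱ Y)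
    (hint : ∀ k, Integrable (Y k) μ)
    (hstep : ∀ k, μ[Y (k + 1) | ℱ k] ≤ᵐ[μ] fun ω => Y k ω + c) (lam : ℝ) (n : ℕ) :
    lam * μ.real {ω | ∃ k < n, lam ≤ Y k ω} + ∫ ω in {ω | ∃ k < n, lam ≤ Y k ω}ᶜ, Y n ω ∂μ ≤
      (∫ ω, Y 0 ω ∂μ) + c * n := by
  induction n with
  | zero => simp
  | succ n ih =>
    set A := {ω | ∃ k < n, lam ≤ Y k ω}
    set A' := {ω | ∃ k < n + 1, lam ≤ Y k ω}
    have hA'n : MeasurableSet[ℱ n] A' := measurableSet_exists_lt_le_of_adapted hadp lam le_rfl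
    have hA' : MeasurableSet A' := ℱ.le n _ hA'n
    have hA : MeasurableSet A :=
      ℱ.le n _ (measurableSet_exists_lt_le_of_adapted hadp lam n.le_succ)
    have h_sub : A ⊆ A' := fun ω ⟨k, hk, h⟩ => ⟨k, by lia, h⟩
    have h_new : ∀ ω ∈ A' \ A, lam ≤ Y n ω := by
      rintro ω ⟨⟨k, hk, h⟩, h_not⟩
      obtain rfl : k = n := by
        by_contra hne
        exact h_not ⟨k, by lia, h⟩
      exact h
    have h_compl : Aᶜ = (A' \ A) ∪ A'ᶜ := by
      ext ω
      have := @h_sub ω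
      simp only [Set.mem_compl_iff, Set.mem_union, Set.mem_sdiff]
      tauto
    have h_split : ∫ ω in Aᶜ, Y n ω ∂μ =
        (∫ ω in A' \ A, Y n ω ∂μ) + ∫ ω in A'ᶜ, Y n ω ∂μ := by
      rw [h_compl]
      exact setIntegral_union (Set.disjoint_left.2 fun ω h h' => h' h.1) hA'.compl
        (hint n).integrableOn (hint n).integrableOn
    have h_level : lam * μ.real (A' \ A) ≤ ∫ ω in A' \ A, Y n ω ∂μ :=
      setIntegral_ge_of_const_le_real (hA'.diff hA) (measure_ne_top _ _) h_new
        (hint n).integrableOn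
    have h_measure : μ.real A' = μ.real A + μ.real (A' \ A) := by
      rw [measureReal_sdiff h_sub hA]
      ring
    have h_incr : ∫ ω in A'ᶜ, Y (n + 1) ω ∂μ ≤ (∫ ω in A'ᶜ, Y n ω ∂μ) + c := by
      calc
        ∫ ω in A'ᶜ, Y (n + 1) ω ∂μ = ∫ ω in A'ᶜ, (μ[Y (n + 1) | ℱ n]) ω ∂μ :=
          (setIntegral_condExp (ℱ.le n) (hint (n + 1)) hA'n.compl).symm
        _ ≤ ∫ ω in A'ᶜ, (Y n ω + c) ∂μ :=
          setIntegral_mono_ae integrable_condExp.integrableOn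
            ((hint n).add (integrable_const c)).integrableOn (hstep n)
        _ = (∫ ω in A'ᶜ, Y n ω ∂μ) + μ.real A'ᶜ * c := by
          rw [integral_add (hint n).integrableOn (integrable_const c), setIntegral_const,
            smul_eq_mul]
        _ ≤ (∫ ω in A'ᶜ, Y n ω ∂μ) + c := by
          gcongr
          exact mul_le_of_le_one_left hc measureReal_le_one
    rw [h_measure]
    push_cast
    linarith

/-- The paper's Lemma 3.4: maximal inequality for nonnegative processes satisfying the
`c`-relaxed supermartingale condition `μ[Y (k+1) | ℱ k] ≤ Y k + c` a.e. -/
theorem relaxed_supermartingale_maximal_ineq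
    {Ω : Type*} {mΩ : MeasurableSpace Ω} {μ : Measure Ω} [IsProbabilityMeasure μ]
    (ℱ : Filtration ℕ mΩ) (c : ℝ) (hc : 0 ≤ c)
    (Y : ℕ → Ω → ℝ) (hadp : Adapted ℱ Y)
    (hint : ∀ k, Integrable (Y k) μ)
    (hnonneg : ∀ k, 0 ≤ᵐ[μ] Y k)
    (hstep : ∀ k, μ[Y (k + 1) | ℱ k] ≤ᵐ[μ] fun ω => Y k ω + c)
    (lam : ℝ) (hlam : 0 < lam) (Td : ℕ) :
    μ {ω | ∃ k < Td, lam ≤ Y k ω} ≤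
      ENNReal.ofReal (((∫ ω, Y 0 ω ∂μ) + c * Td) / lam) := by
  have h_main := mul_measureReal_add_setIntegral_compl_le hc hadp hint hstep lam Td
  have h_nonneg : 0 ≤ ∫ ω in {ω | ∃ k < Td, lam ≤ Y k ω}ᶜ, Y Td ω ∂μ :=
    integral_nonneg_of_ae (ae_restrict_of_ae (hnonneg Td))
  rw [← ofReal_measureReal]
  apply ENNReal.ofReal_le_ofReal
  rw [le_div_iff₀ hlam]
  linarith
end

section
/- Let (Ω, 𝒜, μ) be a probability space equipped with a filtration (ℱ_k)_{k∈ℕ}, let (S, 𝒮) be a measurable space, and let (x_k)_{k∈ℕ} be an S-valued process such that each x_k is ℱ_k-measurable. Let B : S → ℝ be measurable with B(s) ≥ 0 for all s ∈ S, assume B ∘ x_k is integrable for every k, and assume there is a constant c ≥ 0 such that μ[B ∘ x_{k+1} | ℱ_k] ≤ B ∘ x_k + c μ-almost everywhere for every k ∈ ℕ. Let X_a, X_b ∈ 𝒮 and γ ∈ [0,1] be such that B(s) ≤ γ for all s ∈ X_a and B(s) ≥ 1 for all s ∈ X_b, and suppose x_0(ω) ∈ X_a for μ-almost every ω. Then for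 every T_d ∈ ℕ, μ{ω ∈ Ω | ∃ k < T_d, x_k(ω) ∈ X_b} ≤ γ + c·T_d. -/
open MeasureTheory Filter

/-- If `f` increases by at most `c` in conditional mean at each step and `f j ≥ 1` on the
adapted events `E j`, then the probability that some `E j` with `j < n` occurs, plus the mean
of `f n` on the complementary event, is at most the initial mean of `f` plus `c * n`. -/
theorem measureReal_exists_lt_add_setIntegral_le
    {Ω : Type*} {mΩ : MeasurableSpace Ω} {μ : Measure Ω} [IsProbabilityMeasure μ]
    (ℱ : Filtration ℕ mΩ) {f : ℕ → Ω → ℝ} (hint : ∀ k, Integrable (f k) μ)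
    {c : ℝ} (hc : 0 ≤ c) (hstep : ∀ k, μ[f (k + 1) | ℱ k] ≤ᵐ[μ] fun ω => f k ω + c)
    {E : ℕ → Set Ω} (hE : ∀ k, MeasurableSet[ℱ k] (E k)) (hfE : ∀ k, ∀ ω ∈ E k, 1 ≤ f k ω)
    (n : ℕ) :
    μ.real {ω | ∃ k < n, ω ∈ E k} + ∫ ω in {ω | ∃ k < n, ω ∈ E k}ᶜ, f n ω ∂μ
      ≤ ∫ ω, f 0 ω ∂μ + c * n := by
  induction n with
  | zero => simp
  | succ n ih =>
    set A : Set Ω := {ω | ∃ k < n, ω ∈ E k} with hA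
    have hsucc : {ω | ∃ k < n + 1, ω ∈ E k} = A ∪ E n := by
      ext ω
      simp only [hA, Set.mem_ofPred_eq, Set.mem_union]
      exact Nat.exists_lt_succ_right
    rw [hsucc]
    have hAn : MeasurableSet[ℱ n] A := by
      have : A = ⋃ k, ⋃ _ : k < n, E k := by ext ω; simp [hA]
      rw [this]
      exact MeasurableSet.iUnion fun k => MeasurableSet.iUnion fun hk => ℱ.mono hk.le _ (hE k)
    have hCn : MeasurableSet[ℱ n] (A ∪ E n)ᶜ := (hAn.union (hE n)).compl
    have hA' : MeasurableSet A := ℱ.le n _ hAn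
    have hE' : MeasurableSet (E n) := ℱ.le n _ (hE n)
    have hC' : MeasurableSet (A ∪ E n)ᶜ := ℱ.le n _ hCn
    have hD' : MeasurableSet (E n \ A) := hE'.diff hA'
    have hnext : ∫ ω in (A ∪ E n)ᶜ, f (n + 1) ω ∂μ ≤ ∫ ω in (A ∪ E n)ᶜ, f n ω ∂μ + c := by
      rw [← setIntegral_condExp (ℱ.le n) (hint (n + 1)) hCn]
      calc ∫ ω in (A ∪ E n)ᶜ, (μ[f (n + 1) | ℱ n]) ω ∂μ
          ≤ ∫ ω in (A ∪ E n)ᶜ, (f n ω + c) ∂μ :=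
            setIntegral_mono_ae integrable_condExp.integrableOn
              ((hint n).add (integrable_const c)).integrableOn (hstep n)
        _ = ∫ ω in (A ∪ E n)ᶜ, f n ω ∂μ + μ.real (A ∪ E n)ᶜ * c := by
            rw [integral_add (hint n).integrableOn (integrable_const c).integrableOn,
              setIntegral_const, smul_eq_mul]
        _ ≤ ∫ ω in (A ∪ E n)ᶜ, f n ω ∂μ + c := by
            gcongr
            exact mul_le_of_le_one_left hc measureReal_le_one
    have hmeas : μ.real (A ∪ E n) = μ.real A + μ.real (E n \ A) := by
      rw [← Set.union_sdiff_self, measureReal_union Set.disjoint_sdiff_right hD']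
    have hsplit : ∫ ω in Aᶜ, f n ω ∂μ
        = ∫ ω in (A ∪ E n)ᶜ, f n ω ∂μ + ∫ ω in E n \ A, f n ω ∂μ := by
      rw [← setIntegral_union _ hD' (hint n).integrableOn (hint n).integrableOn]
      · congr 2
        ext ω
        by_cases h : ω ∈ E n <;> simp [h]
      · exact Set.disjoint_left.2 fun ω h h' => h (Or.inr h'.1)
    have hhit : μ.real (E n \ A) ≤ ∫ ω in E n \ A, f n ω ∂μ := by
      calc μ.real (E n \ A) = ∫ _ in E n \ A, (1 : ℝ) ∂μ := by simp
        _ ≤ ∫ ω in E n \ A, f n ω ∂μ :=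
            setIntegral_mono_on (integrable_const 1).integrableOn (hint n).integrableOn hD'
              fun ω hω => hfE n ω hω.1
    push_cast
    linarith

/-- The paper's Theorem 3.5 at the level of an adapted stochastic process: a control
barrier certificate `B` (nonnegative, satisfying the `c`-relaxed supermartingale
condition along the process) that is at most `γ` on the initial set `Xa` and at least `1`
on the target set `Xb` bounds the probability of reaching `Xb` within `[0, Td)` by
`γ + c·Td`. -/
theorem barrier_certificate_reach_bound
    {Ω : Type*} {mΩ : MeasurableSpace Ω} {μ : Measure Ω} [IsProbabilityMeasure μ]
    (ℱ : Filtration ℕ mΩ)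
    {S : Type*} [MeasurableSpace S]
    (x : ℕ → Ω → S) (hx : ∀ k, Measurable[ℱ k] (x k))
    (B : S → ℝ) (hBmeas : Measurable B) (hBnonneg : ∀ s, 0 ≤ B s)
    (hint : ∀ k, Integrable (fun ω => B (x k ω)) μ)
    (c : ℝ) (hc : 0 ≤ c)
    (hstep : ∀ k, μ[(fun ω => B (x (k + 1) ω)) | ℱ k] ≤ᵐ[μ] fun ω => B (x k ω) + c)
    (Xa Xb : Set S) (hXa : MeasurableSet Xa) (hXb : MeasurableSet Xb)
    (γ : ℝ) (hγ0 : 0 ≤ γ) (hγ1 : γ ≤ 1)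
    (hBXa : ∀ s ∈ Xa, B s ≤ γ) (hBXb : ∀ s ∈ Xb, 1 ≤ B s)
    (hx0 : ∀ᵐ ω ∂μ, x 0 ω ∈ Xa)
    (Td : ℕ) :
    μ {ω | ∃ k < Td, x k ω ∈ Xb} ≤ ENNReal.ofReal (γ + c * Td) := by
  have hbound := measureReal_exists_lt_add_setIntegral_le ℱ hint hc hstep
    (E := fun k => x k ⁻¹' Xb) (fun k => hx k hXb) (fun k ω hω => hBXb _ hω) Td
  have hinit : ∫ ω, B (x 0 ω) ∂μ ≤ γ := by
    calc ∫ ω, B (x 0 ω) ∂μ ≤ ∫ _, γ ∂μ :=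
          integral_mono_ae (hint 0) (integrable_const γ) (hx0.mono fun ω hω => hBXa _ hω)
      _ = γ := by simp
  have hrest : 0 ≤ ∫ ω in {ω | ∃ k < Td, ω ∈ x k ⁻¹' Xb}ᶜ, B (x Td ω) ∂μ :=
    integral_nonneg fun ω => hBnonneg _
  rw [← ofReal_measureReal]
  refine ENNReal.ofReal_le_ofReal ?_
  change μ.real {ω | ∃ k < Td, ω ∈ x k ⁻¹' Xb} ≤ γ + c * Td
  linarith
end

section
/- Let M be a deterministic finite automaton with alphabet α and state type σ, with transition function step : σ → α → σ. For a state q : σ and a word w : List α, let trace(q, w) := List.scanl M.step q w be the list of states visited along the run of M on w from q, and let d := List.destutter (· ≠ ·) (trace(q, w)) be the list obtained by deleting every entry equal to its immediate predecessor. Define the relation R on states by R q₁ q₂ ↔ (q₁ ≠ q₂ ∧ ∃ a : α, M.step q₁ a = q₂). Then: (i) no two consecutive entries of d are equal and consecutive entries of d are related by R (d is an R-chain, List.Chain' R d); (ii) the head of d is q; (iii) the last entry of d equals M.evalFrom q w; and (iv) the length of d is at most (length of w) + 1. -/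
namespace List

theorem head?_destutter' {β : Type*} (R : β → β → Prop) [DecidableRel R] (l : List β) (b : β) :
    (l.destutter' R b).head? = some b := by
  induction l generalizing b with
  | nil => simp
  | cons c l ih =>
    rw [destutter'_cons]
    split_ifs
    · rfl
    · exact ih b

theorem getLast?_destutter'_ne {β : Type*} [DecidableEq β] (l : List β) (b : β) :
    (l.destutter' (· ≠ ·) b).getLast? = (b :: l).getLast? := by
  induction l generalizing b with
  | nil => simp
  | cons c l ih =>
    rw [destutter'_cons]
    split_ifs with h
    · simp [getLast?_cons, ih]
    · obtain rfl : b = c := not_not.mp h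
      simp [ih, getLast?_cons]

theorem IsChain.destutter'_ne {β : Type*} [DecidableEq β] {S : β → β → Prop} {l : List β} {b : β}
    (h : (b :: l).IsChain S) :
    (l.destutter' (· ≠ ·) b).IsChain (fun x y => x ≠ y ∧ S x y) := by
  induction l generalizing b with
  | nil => simp
  | cons c l ih =>
    rw [isChain_cons_cons] at h
    rw [destutter'_cons]
    split_ifs with hbc
    · refine List.isChain_cons.mpr ⟨fun y hy => ?_, ih h.2⟩
      obtain rfl : c = y := by simpa [head?_destutter'] using hy
      exact ⟨hbc, h.1⟩
    · obtain rfl : b = c := not_not.mp hbc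
      exact ih h.2

theorem isChain_scanl {α β : Type*} (f : β → α → β) (b : β) (w : List α) :
    (scanl f b w).IsChain (fun x y => ∃ a, f x a = y) := by
  induction w generalizing b with
  | nil => simp
  | cons a w ih =>
    rw [scanl_cons]
    refine isChain_cons.mpr ⟨fun y hy => ?_, ih _⟩
    exact ⟨a, by simpa using hy⟩

end List


/-- Correctness of the decomposition of DFA runs into self-loop-free paths (Section 4 /
Algorithm 1 of the paper): collapsing consecutive repetitions in the state run
`scanl M.step q w` of a DFA on the word `w` yields a list `d` whose consecutive entries
are distinct and joined by single transitions of `M` (a path without self-loops in the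
graph of the DFA), starting at `q`, ending at `M.evalFrom q w`, of length at most
`w.length + 1`. -/
theorem dfa_run_destutter_is_selfloop_free_path
    {α σ : Type*} [DecidableEq σ] (M : DFA α σ) (q : σ) (w : List α) :
    ∀ d : List σ, d = List.destutter (· ≠ ·) (List.scanl M.step q w) →
      List.Chain' (fun q₁ q₂ => q₁ ≠ q₂ ∧ ∃ a : α, M.step q₁ a = q₂) d
      ∧ d.head? = some q
      ∧ d.getLast? = some (M.evalFrom q w)
      ∧ d.length ≤ w.length + 1 := by
  rintro d rfl
  obtain ⟨t, ht⟩ : ∃ t, List.scanl M.step q w = q :: t := by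
    cases w <;> simp
  have hchain := List.isChain_scanl M.step q w
  have hlen := (List.destutter_sublist (· ≠ ·) (List.scanl M.step q w)).length_le
  have hlast : (List.scanl M.step q w).getLast? = some (M.evalFrom q w) := by
    simp [DFA.evalFrom, List.getLast?_scanl]
  rw [List.length_scanl] at hlen
  rw [ht] at hchain hlen hlast ⊢
  rw [List.destutter_cons'] at hlen ⊢
  exact ⟨hchain.destutter'_ne, List.head?_destutter' _ t q,
    (List.getLast?_destutter'_ne t q).trans hlast, hlen⟩
end
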